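/- arXiv:q-alg/9707008 — 3 statements merged into one kernel-verified Lean document; each statement's English description precedes it below -/
import Mathlib

section
/- For the Hamming code H₈ with the marking {(1,2),(3,4),(5,6),(7,8)} the symmetrized marked weight enumerator equals x⁴ + 6x²z² + z⁴ + 8y⁴; with the marking {(1,2),(3,4),(5,7),(6,8)} it equals x⁴ + 2x²z² + z⁴ + 8xzy² + 4y⁴; and with the marking {(1,2),(3,5),(4,7),(6,8)} it equals x⁴ + z⁴ + 12xzy² + 2y⁴. -/
/-- The Hamming code `H₈ ≤ 𝔽₂⁸`. -/
def H8 : Submodule (ZMod 2) (Fin 8 → ZMod 2) :=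
  Submodule.span (ZMod 2)
    {![0,0,0,0,1,1,1,1], ![0,0,1,1,0,0,1,1], ![0,1,0,1,0,1,0,1], ![1,1,1,1,1,1,1,1]}

open scoped Classical in
/-- The symmetrized marked weight enumerator of a code `C` of length 8 with a marking
given as four pairs of coordinates: the polynomial `∑_c x^{#(0,0)} y^{#(1,0),(0,1)}
z^{#(1,1)}` in `ℤ[x,y,z]` with `x = X 0`, `y = X 1`, `z = X 2`. -/
noncomputable def smweP (C : Submodule (ZMod 2) (Fin 8 → ZMod 2))
    (M : Fin 4 → Fin 8 × Fin 8) : MvPolynomial (Fin 3) ℤ :=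
  ∑ c : C,
    MvPolynomial.X 0 ^ (Finset.univ.filter fun k : Fin 4 =>
        (c : Fin 8 → ZMod 2) (M k).1 = 0 ∧ (c : Fin 8 → ZMod 2) (M k).2 = 0).card *
    MvPolynomial.X 1 ^ (Finset.univ.filter fun k : Fin 4 =>
        ((c : Fin 8 → ZMod 2) (M k).1 = 1 ∧ (c : Fin 8 → ZMod 2) (M k).2 = 0) ∨
        ((c : Fin 8 → ZMod 2) (M k).1 = 0 ∧ (c : Fin 8 → ZMod 2) (M k).2 = 1)).card *
    MvPolynomial.X 2 ^ (Finset.univ.filter fun k : Fin 4 =>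
        (c : Fin 8 → ZMod 2) (M k).1 = 1 ∧ (c : Fin 8 → ZMod 2) (M k).2 = 1).card

/-- The codeword of `H₈` with given coefficients on the four generators. -/
def hammingWord (p : ZMod 2 × ZMod 2 × ZMod 2 × ZMod 2) : Fin 8 → ZMod 2 :=
  p.1 • ![0,0,0,0,1,1,1,1] + (p.2.1 • ![0,0,1,1,0,0,1,1] +
    (p.2.2.1 • ![0,1,0,1,0,1,0,1] + p.2.2.2 • ![1,1,1,1,1,1,1,1]))

theorem mem_H8_iff (v : Fin 8 → ZMod 2) : v ∈ H8 ↔ ∃ p, hammingWord p = v := by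
  simp only [H8, Submodule.mem_span_insert, Submodule.mem_span_singleton, hammingWord, Prod.exists]
  constructor
  · rintro ⟨a, _, ⟨b, _, ⟨c, _, ⟨d, rfl⟩, rfl⟩, rfl⟩, rfl⟩
    exact ⟨a, b, c, d, rfl⟩
  · rintro ⟨a, b, c, d, rfl⟩
    exact ⟨a, _, ⟨b, _, ⟨c, _, ⟨d, rfl⟩, rfl⟩, rfl⟩, rfl⟩

theorem hammingWord_injective : Function.Injective hammingWord := by
  intro p q h
  have h0 := congrFun h 0
  have h1 := congrFun h 1
  have h2 := congrFun h 2
  have h4 := congrFun h 4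
  simp [hammingWord] at h0 h1 h2 h4
  ext <;> simp_all

/-- The numbers of pairs of the marking `M` on which `v` is `(0,0)`, mixed, and `(1,1)`. -/
def pairCounts (M : Fin 4 → Fin 8 × Fin 8) (v : Fin 8 → ZMod 2) : ℕ × ℕ × ℕ :=
  ((Finset.univ.filter fun k : Fin 4 => v (M k).1 = 0 ∧ v (M k).2 = 0).card,
   (Finset.univ.filter fun k : Fin 4 =>
      (v (M k).1 = 1 ∧ v (M k).2 = 0) ∨ (v (M k).1 = 0 ∧ v (M k).2 = 1)).card,
   (Finset.univ.filter fun k : Fin 4 => v (M k).1 = 1 ∧ v (M k).2 = 1).card)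

/-- The monomial `x ^ a * y ^ b * z ^ c`. -/
noncomputable def markedMonomial (e : ℕ × ℕ × ℕ) : MvPolynomial (Fin 3) ℤ :=
  MvPolynomial.X 0 ^ e.1 * MvPolynomial.X 1 ^ e.2.1 * MvPolynomial.X 2 ^ e.2.2

theorem smweP_H8_eq_sum (M : Fin 4 → Fin 8 × Fin 8) :
    smweP H8 M = ((Finset.univ.val.map fun p => pairCounts M (hammingWord p)).map
      markedMonomial).sum := by
  classical
  have hbij : Function.Bijective
      (fun p => (⟨hammingWord p, (mem_H8_iff _).2 ⟨p, rfl⟩⟩ : H8)) :=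
    ⟨fun p q h => hammingWord_injective (congrArg Subtype.val h),
      fun ⟨v, hv⟩ => ((mem_H8_iff v).1 hv).imp fun p hp => Subtype.ext hp⟩
  rw [smweP, ← hbij.sum_comp, Multiset.map_map]
  refine Finset.sum_congr rfl fun p _ => ?_
  simp only [Function.comp_apply, markedMonomial, pairCounts]

open MvPolynomial in
/-- The symmetrized marked weight enumerators of the Hamming code `H₈` for the three
markings `{(1,2),(3,4),(5,6),(7,8)}`, `{(1,2),(3,4),(5,7),(6,8)}` and
`{(1,2),(3,5),(4,7),(6,8)}` (written 0-indexed). -/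
theorem stmt_5 :
    smweP H8 ![(0,1),(2,3),(4,5),(6,7)] =
      X 0 ^ 4 + 6 * X 0 ^ 2 * X 2 ^ 2 + X 2 ^ 4 + 8 * X 1 ^ 4 ∧
    smweP H8 ![(0,1),(2,3),(4,6),(5,7)] =
      X 0 ^ 4 + 2 * X 0 ^ 2 * X 2 ^ 2 + X 2 ^ 4 + 8 * X 0 * X 2 * X 1 ^ 2 + 4 * X 1 ^ 4 ∧
    smweP H8 ![(0,1),(2,4),(3,6),(5,7)] =
      X 0 ^ 4 + X 2 ^ 4 + 12 * X 0 * X 2 * X 1 ^ 2 + 2 * X 1 ^ 4 := by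
  refine ⟨?_, ?_, ?_⟩
  · have h : (Finset.univ.val.map fun p =>
        pairCounts ![(0,1),(2,3),(4,5),(6,7)] (hammingWord p)) =
        Multiset.replicate 1 (4, 0, 0) + Multiset.replicate 6 (2, 0, 2) + Multiset.replicate 1 (0, 0, 4) +
        Multiset.replicate 8 (0, 4, 0) := by
      decide
    rw [smweP_H8_eq_sum, h]
    simp [markedMonomial]
    ring
  · have h : (Finset.univ.val.map fun p =>
        pairCounts ![(0,1),(2,3),(4,6),(5,7)] (hammingWord p)) =
        Multiset.replicate 1 (4, 0, 0) + Multiset.replicate 2 (2, 0, 2) +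
        Multiset.replicate 1 (0, 0, 4) +
        Multiset.replicate 8 (1, 2, 1) + Multiset.replicate 4 (0, 4, 0) := by
      decide
    rw [smweP_H8_eq_sum, h]
    simp [markedMonomial]
    ring
  · have h : (Finset.univ.val.map fun p =>
        pairCounts ![(0,1),(2,4),(3,6),(5,7)] (hammingWord p)) =
        Multiset.replicate 1 (4, 0, 0) + Multiset.replicate 1 (0, 0, 4) +
        Multiset.replicate 12 (1, 2, 1) + Multiset.replicate 2 (0, 4, 0) := by
      decide
    rw [smweP_H8_eq_sum, h]
    simp [markedMonomial]
    ring
end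

section
/- Every 2-element subset of the coordinate set {1,…,8} is contained in exactly one of the 7 markings lying in the Aut(H₈)-orbit of the marking {{1,2},{3,4},{5,6},{7,8}}. -/
/-- A coordinate permutation is an automorphism of `H₈` if it preserves the code. -/
def IsAutH8 (σ : Equiv.Perm (Fin 8)) : Prop := ∀ c ∈ H8, c ∘ ⇑σ ∈ H8

/-- A marking: a partition of the 8 coordinates into four 2-element sets. -/
def IsMarking (M : Finset (Finset (Fin 8))) : Prop :=
  (∀ p ∈ M, p.card = 2) ∧ (∀ i : Fin 8, ∃ p ∈ M, i ∈ p) ∧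
    (M : Set (Finset (Fin 8))).PairwiseDisjoint id

/-- The action of a coordinate permutation on a marking. -/
def markAct (σ : Equiv.Perm (Fin 8)) (M : Finset (Finset (Fin 8))) :
    Finset (Finset (Fin 8)) :=
  M.image (Finset.image σ)

/-- `M` lies in the `Aut(H₈)`-orbit of `N`. -/
def InOrbit (M N : Finset (Finset (Fin 8))) : Prop :=
  ∃ σ : Equiv.Perm (Fin 8), IsAutH8 σ ∧ M = markAct σ N

def M1 : Finset (Finset (Fin 8)) := {{0,1},{2,3},{4,5},{6,7}}
def M2 : Finset (Finset (Fin 8)) := {{0,1},{2,3},{4,6},{5,7}}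
def M3 : Finset (Finset (Fin 8)) := {{0,1},{2,4},{3,6},{5,7}}


/-- The marking of the coordinates, regarded as `𝔽₂³`, into pairs differing by `d`. -/
def translationMarking (d : Fin 8) : Finset (Finset (Fin 8)) :=
  Finset.univ.image fun x => {x, x ^^^ d}

lemma xor_xor_cancel_left (x y : Fin 8) : x ^^^ (x ^^^ y) = y := by
  revert x y; decide

lemma M1_eq_translationMarking : M1 = translationMarking 1 := by
  decide

lemma pair_mem_translationMarking_iff {a b : Fin 8} (d : Fin 8) :
    ({a, b} : Finset (Fin 8)) ∈ translationMarking d ↔ a ^^^ b = d := by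
  have xor_comm : ∀ x y : Fin 8, x ^^^ y = y ^^^ x := by decide
  simp only [translationMarking, Finset.mem_image, Finset.mem_univ, true_and]
  constructor
  · rintro ⟨x, hx⟩
    rw [← Finset.coe_inj, Finset.coe_pair, Finset.coe_pair, Set.pair_eq_pair_iff] at hx
    rcases hx with ⟨rfl, rfl⟩ | ⟨rfl, rfl⟩
    · exact xor_xor_cancel_left _ _
    · rw [xor_comm, xor_xor_cancel_left]
  · rintro rfl
    exact ⟨a, by rw [xor_xor_cancel_left]⟩

/-- The codewords of `H₈` are the affine functions on `𝔽₂³`. -/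
lemma mem_H8_iff_s6 (c : Fin 8 → ZMod 2) :
    c ∈ H8 ↔ ∀ x y : Fin 8, c (x ^^^ y) = c x + c y + c 0 := by
  constructor
  · intro hc
    induction hc using Submodule.span_induction with
    | mem c hc =>
      rcases hc with rfl | rfl | rfl | rfl <;> decide
    | zero => simp
    | add u v _ _ hu hv =>
      intro x y
      simp only [Pi.add_apply, hu x y, hv x y]
      ring
    | smul r u _ hu =>
      intro x y
      simp only [Pi.smul_apply, smul_eq_mul, hu x y]
      ring
  · intro h
    have h3 := h 1 2
    have h5 := h 1 4
    have h6 := h 2 4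
    have h7 := h 3 4
    rw [show (1 ^^^ 2 : Fin 8) = 3 by decide] at h3
    rw [show (1 ^^^ 4 : Fin 8) = 5 by decide] at h5
    rw [show (2 ^^^ 4 : Fin 8) = 6 by decide] at h6
    rw [show (3 ^^^ 4 : Fin 8) = 7 by decide, h3] at h7
    have hc : c = (c 4 + c 0) • ![0,0,0,0,1,1,1,1] + (c 2 + c 0) • ![0,0,1,1,0,0,1,1]
        + (c 1 + c 0) • ![0,1,0,1,0,1,0,1] + c 0 • ![1,1,1,1,1,1,1,1] := by
      funext i
      fin_cases i <;> simp [h3, h5, h6, h7] <;>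
        generalize c 0 = c₀, c 1 = c₁, c 2 = c₂, c 4 = c₄ <;> decide +revert
    rw [hc]
    refine add_mem (add_mem (add_mem ?_ ?_) ?_) ?_ <;>
      exact Submodule.smul_mem _ _ (Submodule.subset_span (by simp))

lemma isAutH8_of_map_xor {σ : Equiv.Perm (Fin 8)}
    (hσ : ∀ x y, σ (x ^^^ y) = σ x ^^^ σ y) : IsAutH8 σ := by
  intro c hc
  rw [mem_H8_iff_s6] at hc ⊢
  have h0 : σ 0 = 0 := by
    have h := hσ 0 0
    have self_xor : ∀ x : Fin 8, x ^^^ x = 0 := by decide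
    rwa [self_xor, self_xor] at h
  intro x y
  simp only [Function.comp_apply, hσ, h0, hc (σ x) (σ y)]

/-- Automorphisms of `H₈` are affine maps of `𝔽₂³`. -/
lemma IsAutH8.map_xor {σ : Equiv.Perm (Fin 8)} (hσ : IsAutH8 σ) (x y : Fin 8) :
    σ (x ^^^ y) = σ x ^^^ (σ 0 ^^^ σ y) := by
  have separated : ∀ a b : Fin 8,
      (![0,0,0,0,1,1,1,1] : Fin 8 → ZMod 2) a = ![0,0,0,0,1,1,1,1] b →
      (![0,0,1,1,0,0,1,1] : Fin 8 → ZMod 2) a = ![0,0,1,1,0,0,1,1] b →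
      (![0,1,0,1,0,1,0,1] : Fin 8 → ZMod 2) a = ![0,1,0,1,0,1,0,1] b → a = b := by
    decide
  have codeword : ∀ c ∈ H8, c 0 = 0 → c (σ (x ^^^ y)) = c (σ x ^^^ (σ 0 ^^^ σ y)) := by
    intro c hc hc0
    have h := (mem_H8_iff_s6 _).1 (hσ c hc) x y
    rw [mem_H8_iff_s6] at hc
    simp only [Function.comp_apply] at h
    rw [h, hc, hc, hc0]
    ring
  refine separated _ _ (codeword _ ?_ rfl) (codeword _ ?_ rfl) (codeword _ ?_ rfl) <;>
    exact Submodule.subset_span (by simp)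

lemma IsAutH8.markAct_M1 {σ : Equiv.Perm (Fin 8)} (hσ : IsAutH8 σ) :
    markAct σ M1 = translationMarking (σ 0 ^^^ σ 1) := by
  rw [M1_eq_translationMarking, markAct, translationMarking, translationMarking,
    Finset.image_image]
  conv_rhs => rw [← Finset.image_univ_equiv σ, Finset.image_image]
  congr 1
  funext x
  simp [Finset.image_insert, hσ.map_xor]

/-- The linear map `x ↦ x + ⟨t, x⟩ v` of `𝔽₂³`. -/
def transvection (t v x : Fin 8) : Fin 8 :=
  if t &&& x ∈ ({0, 3, 5, 6} : Finset (Fin 8)) then x else x ^^^ v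

/-- The linear group of `𝔽₂³` is transitive on nonzero vectors. -/
lemma exists_isAutH8_map_one {d : Fin 8} (hd : d ≠ 0) :
    ∃ σ : Equiv.Perm (Fin 8), IsAutH8 σ ∧ σ 0 ^^^ σ 1 = d := by
  have key : ∀ d : Fin 8, d ≠ 0 → ∃ t : Fin 8,
      (∀ x, transvection t (d ^^^ 1) (transvection t (d ^^^ 1) x) = x) ∧
      (∀ x y, transvection t (d ^^^ 1) (x ^^^ y) =
        transvection t (d ^^^ 1) x ^^^ transvection t (d ^^^ 1) y) ∧
      transvection t (d ^^^ 1) 0 ^^^ transvection t (d ^^^ 1) 1 = d := by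
    decide +kernel
  obtain ⟨t, hinv, hadd, hone⟩ := key d hd
  exact ⟨Function.Involutive.toPerm (transvection t (d ^^^ 1)) hinv,
    isAutH8_of_map_xor hadd, hone⟩

/-- Every 2-element subset of the 8 coordinates is contained in exactly one of the
markings lying in the `Aut(H₈)`-orbit of `M1 = {{1,2},{3,4},{5,6},{7,8}}`. -/
theorem stmt_6 (p : Finset (Fin 8)) (hp : p.card = 2) :
    ∃! M : Finset (Finset (Fin 8)), InOrbit M M1 ∧ p ∈ M := by
  obtain ⟨a, b, hab, rfl⟩ := Finset.card_eq_two.1 hp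
  have hd : a ^^^ b ≠ 0 := by
    intro h
    have h' := xor_xor_cancel_left a b
    have xor_zero : ∀ x : Fin 8, x ^^^ 0 = x := by decide
    rw [h, xor_zero] at h'
    exact hab h'
  obtain ⟨σ, hσ, hσd⟩ := exists_isAutH8_map_one hd
  refine ⟨translationMarking (a ^^^ b), ⟨⟨σ, hσ, ?_⟩, ?_⟩, ?_⟩
  · rw [hσ.markAct_M1, hσd]
  · exact (pair_mem_translationMarking_iff _).2 rfl
  · rintro _ ⟨⟨τ, hτ, rfl⟩, hp⟩
    rw [hτ.markAct_M1, pair_mem_translationMarking_iff] at hp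
    rw [hτ.markAct_M1, hp]
end

section
/- Let d ≥ 1, let V = (ZMod 2)^d, let Ω = Fin 3 × V, and let D ⊆ (ZMod 2)^Ω be the 𝔽₂-span of the three block indicator functions (i,v) ↦ [i = i₀] for i₀ ∈ Fin 3 together with the d functions (i,v) ↦ v_j for j = 1, …, d. Then the group F of permutations σ of Ω with c ∘ σ ∈ D for all c ∈ D has order 2^{3d} · 6 · |GL(d, 𝔽₂)| = 2^{3d} · 6 · ∏_{k=0}^{d−1}(2^d − 2^k); it is isomorphic to a group of shape 2^{3d}[GL(d,2) × Sym₃], namely the semidirect product of the translation group (Fin 3 → V) by GL(V) × Perm(Fin 3) acting naturally. -/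
open scoped Classical

/-- The code `D` of length `3·2^d` on the index set `Ω = Fin 3 × (ZMod 2)^d`. -/
def codeD (d : ℕ) : Submodule (ZMod 2) ((Fin 3 × (Fin d → ZMod 2)) → ZMod 2) :=
  Submodule.span (ZMod 2)
    ({f | ∃ i₀ : Fin 3, f = fun p => if p.1 = i₀ then 1 else 0} ∪
      {f | ∃ j : Fin d, f = fun p => p.2 j})

/-- The natural action of `GL(V) × Sym₃` on the translation group `Fin 3 → V`,
`(A, π) • t = fun i => A (t (π⁻¹ i))`, as an additive automorphism. -/
def natActEquiv (d : ℕ)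
    (g : ((Fin d → ZMod 2) ≃ₗ[ZMod 2] (Fin d → ZMod 2)) × Equiv.Perm (Fin 3)) :
    (Fin 3 → Fin d → ZMod 2) ≃+ (Fin 3 → Fin d → ZMod 2) where
  toFun t i := g.1 (t (g.2.symm i))
  invFun t i := g.1.symm (t (g.2 i))
  left_inv t := by funext i; simp
  right_inv t := by funext i; simp
  map_add' s t := by funext i; simp

/-- The natural action of `GL(V) × Sym₃` on the (multiplicatively written) translation
group `Fin 3 → V`, as a homomorphism into its automorphism group. -/
def natAct (d : ℕ) :
    (((Fin d → ZMod 2) ≃ₗ[ZMod 2] (Fin d → ZMod 2)) × Equiv.Perm (Fin 3)) →*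
      MulAut (Multiplicative (Fin 3 → Fin d → ZMod 2)) where
  toFun g := AddEquiv.toMultiplicative (natActEquiv d g)
  map_one' := by ext t; rfl
  map_mul' g h := by ext t; rfl

/-- Codewords of `codeD d` are the functions `(i, v) ↦ a i + ℓ v` with `ℓ` linear. -/
theorem mem_codeD_iff {d : ℕ} {c : Fin 3 × (Fin d → ZMod 2) → ZMod 2} :
    c ∈ codeD d ↔ ∃ (a : Fin 3 → ZMod 2) (l : (Fin d → ZMod 2) →ₗ[ZMod 2] ZMod 2),
      ∀ p, c p = a p.1 + l p.2 := by
  constructor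
  · intro hc
    induction hc using Submodule.span_induction with
    | mem x hx =>
      rcases hx with ⟨i₀, rfl⟩ | ⟨j, rfl⟩
      · exact ⟨fun i => if i = i₀ then 1 else 0, 0, fun p => by simp⟩
      · exact ⟨0, LinearMap.proj j, fun p => by simp⟩
    | zero => exact ⟨0, 0, fun p => by simp⟩
    | add x y _ _ hx hy =>
      obtain ⟨a, l, h⟩ := hx
      obtain ⟨b, m, k⟩ := hy
      refine ⟨a + b, l + m, fun p => ?_⟩
      simp only [Pi.add_apply, h, k, LinearMap.add_apply]
      ring
    | smul r x _ hx =>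
      obtain ⟨a, l, h⟩ := hx
      exact ⟨r • a, r • l, fun p => by simp [h, mul_add]⟩
  · rintro ⟨a, l, h⟩
    have hc : c = (∑ i₀ : Fin 3, a i₀ • fun p : Fin 3 × (Fin d → ZMod 2) =>
        if p.1 = i₀ then (1 : ZMod 2) else 0) +
        ∑ j : Fin d, l (Pi.single j 1) • fun p : Fin 3 × (Fin d → ZMod 2) => p.2 j := by
      funext p
      have hl : l p.2 = ∑ j, l (Pi.single j 1) * p.2 j := by
        conv_lhs => rw [pi_eq_sum_univ' p.2, map_sum]
        refine Finset.sum_congr rfl fun j _ => ?_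
        rw [map_smul, smul_eq_mul, mul_comm]
      rw [h p, hl]
      simp
    rw [hc]
    refine add_mem (Submodule.sum_mem _ fun i₀ _ => Submodule.smul_mem _ _ ?_)
      (Submodule.sum_mem _ fun j _ => Submodule.smul_mem _ _ ?_)
    · exact Submodule.subset_span (Or.inl ⟨i₀, rfl⟩)
    · exact Submodule.subset_span (Or.inr ⟨j, rfl⟩)

/-- The permutation `(i, v) ↦ (π i, A v + t (π i))` of `Fin 3 × V`. -/
def affinePerm {d : ℕ} (t : Fin 3 → Fin d → ZMod 2)
    (A : (Fin d → ZMod 2) ≃ₗ[ZMod 2] (Fin d → ZMod 2)) (π : Equiv.Perm (Fin 3)) :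
    Equiv.Perm (Fin 3 × (Fin d → ZMod 2)) where
  toFun p := (π p.1, A p.2 + t (π p.1))
  invFun p := (π.symm p.1, A.symm (p.2 - t p.1))
  left_inv p := by simp
  right_inv p := by simp

@[simp]
theorem affinePerm_apply {d : ℕ} (t : Fin 3 → Fin d → ZMod 2)
    (A : (Fin d → ZMod 2) ≃ₗ[ZMod 2] (Fin d → ZMod 2)) (π : Equiv.Perm (Fin 3))
    (p : Fin 3 × (Fin d → ZMod 2)) :
    affinePerm t A π p = (π p.1, A p.2 + t (π p.1)) := rfl

/-- The action of the semidirect product on `Fin 3 × V` by affine permutations. -/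
def affinePermHom (d : ℕ) :
    SemidirectProduct (Multiplicative (Fin 3 → Fin d → ZMod 2))
      (((Fin d → ZMod 2) ≃ₗ[ZMod 2] (Fin d → ZMod 2)) × Equiv.Perm (Fin 3)) (natAct d) →*
      Equiv.Perm (Fin 3 × (Fin d → ZMod 2)) where
  toFun g := affinePerm g.left.toAdd g.right.1 g.right.2
  map_one' := by
    ext p : 1
    simp
  map_mul' g h := by
    ext p : 1
    have key : ∀ i, ((natAct d g.right) h.left).toAdd i =
        g.right.1 (h.left.toAdd (g.right.2.symm i)) := fun _ => rfl
    simp [key, add_comm, add_left_comm]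

theorem affinePermHom_injective (d : ℕ) : Function.Injective (affinePermHom d) := by
  intro g h hgh
  have key : ∀ i v, (g.right.2 i, g.right.1 v + g.left.toAdd (g.right.2 i)) =
      (h.right.2 i, h.right.1 v + h.left.toAdd (h.right.2 i)) :=
    fun i v => DFunLike.congr_fun hgh (i, v)
  simp only [Prod.mk.injEq] at key
  have hπ : g.right.2 = h.right.2 := Equiv.ext fun i => (key i 0).1
  have ht : g.left.toAdd = h.left.toAdd := by
    funext i
    have := (key (g.right.2.symm i) 0).2
    rw [← hπ] at this
    simpa using this
  have hA : g.right.1 = h.right.1 := by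
    refine LinearEquiv.ext fun v => ?_
    have := (key 0 v).2
    rw [← hπ, ht] at this
    exact add_right_cancel this
  exact SemidirectProduct.ext ht (Prod.ext hA hπ)

theorem comp_affinePerm_mem_codeD {d : ℕ} (t : Fin 3 → Fin d → ZMod 2)
    (A : (Fin d → ZMod 2) ≃ₗ[ZMod 2] (Fin d → ZMod 2)) (π : Equiv.Perm (Fin 3))
    {c : Fin 3 × (Fin d → ZMod 2) → ZMod 2} (hc : c ∈ codeD d) :
    c ∘ affinePerm t A π ∈ codeD d := by
  obtain ⟨a, l, h⟩ := mem_codeD_iff.1 hc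
  refine mem_codeD_iff.2 ⟨fun i => a (π i) + l (t (π i)), l ∘ₗ A.toLinearMap, fun p => ?_⟩
  simp [h, add_comm, add_assoc]

/-- A codeword with as many ones as a block has points is constant on blocks: a nonzero linear
part would make exactly half of its values equal to one. -/
theorem linear_part_eq_zero {d : ℕ} {i₀ : Fin 3} {σ : Equiv.Perm (Fin 3 × (Fin d → ZMod 2))}
    {a : Fin 3 → ZMod 2} {l : (Fin d → ZMod 2) →ₗ[ZMod 2] ZMod 2}
    (h : ∀ p, (if (σ p).1 = i₀ then (1 : ZMod 2) else 0) = a p.1 + l p.2) : l = 0 := by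
  by_contra hl
  obtain ⟨u, hu⟩ : ∃ u, l u ≠ 0 := by
    by_contra! H
    exact hl (LinearMap.ext H)
  have hu1 : l u = 1 := by
    generalize l u = x at hu
    revert x
    decide
  have hswap : ∀ p : Fin 3 × (Fin d → ZMod 2),
      (σ (p.1, p.2 + u)).1 = i₀ ↔ ¬ (σ p).1 = i₀ := by
    intro p
    have h₁ := h p
    have h₂ := h (p.1, p.2 + u)
    rw [map_add, hu1, ← add_assoc, ← h₁] at h₂
    by_cases hp : (σ p).1 = i₀ <;> by_cases hq : (σ (p.1, p.2 + u)).1 = i₀ <;>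
      simp [hp, hq] at h₂ ⊢
  have hcompl : Nat.card {p // (σ p).1 = i₀} = Nat.card {p // ¬ (σ p).1 = i₀} :=
    Nat.card_congr (((Equiv.refl (Fin 3)).prodCongr (Equiv.addRight (-u))).subtypeEquiv
      fun p => by
        have := hswap (p.1, p.2 + -u)
        simpa [Prod.map] using this)
  have hmove : Nat.card {p // (σ p).1 = i₀} =
      Nat.card {p : Fin 3 × (Fin d → ZMod 2) // p.1 = i₀} :=
    Nat.card_congr (σ.subtypeEquiv fun p => Iff.rfl)
  have hblock : Nat.card {p : Fin 3 × (Fin d → ZMod 2) // p.1 = i₀} = 2 ^ d := by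
    rw [Nat.card_congr (β := Fin d → ZMod 2)
      ⟨fun p => p.1.2, fun v => ⟨(i₀, v), rfl⟩, fun ⟨⟨i, v⟩, hp⟩ => by subst hp; rfl,
        fun _ => rfl⟩]
    simp
  have htotal : Nat.card {p // (σ p).1 = i₀} + Nat.card {p // ¬ (σ p).1 = i₀} = 3 * 2 ^ d := by
    rw [← Nat.card_sum, Nat.card_congr (Equiv.sumCompl fun p => (σ p).1 = i₀)]
    simp
  have : 0 < 2 ^ d := by positivity
  omega

theorem exists_eq_affinePerm {d : ℕ} {σ : Equiv.Perm (Fin 3 × (Fin d → ZMod 2))}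
    (hσ : ∀ c ∈ codeD d, c ∘ σ ∈ codeD d) : ∃ t A π, σ = affinePerm t A π := by
  have hblock : ∀ i v, (σ (i, v)).1 = (σ (i, 0)).1 := by
    intro i v
    obtain ⟨a, l, h⟩ := mem_codeD_iff.1
      (hσ _ (Submodule.subset_span (Or.inl ⟨(σ (i, 0)).1, rfl⟩)))
    simp only [Function.comp_apply] at h
    have hl := linear_part_eq_zero h
    have h₁ := h (i, v)
    rw [hl, LinearMap.zero_apply] at h₁
    have h₂ := h (i, 0)
    rw [hl, LinearMap.zero_apply] at h₂
    rw [← h₁] at h₂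
    simpa using h₂
  have hcoord : ∀ j : Fin d, ∃ (a : Fin 3 → ZMod 2)
      (l : (Fin d → ZMod 2) →ₗ[ZMod 2] ZMod 2), ∀ p, (σ p).2 j = a p.1 + l p.2 :=
    fun j => mem_codeD_iff.1 (hσ _ (Submodule.subset_span (Or.inr ⟨j, rfl⟩)))
  choose a l hal using hcoord
  have hsnd : ∀ p, (σ p).2 = LinearMap.pi l p.2 + fun j => a j p.1 := by
    intro p
    funext j
    simp [hal, add_comm]
  have hπ : Function.Bijective fun i => (σ (i, 0)).1 := by
    refine Function.Surjective.bijective_of_finite fun i => ?_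
    refine ⟨(σ.symm (i, 0)).1, ?_⟩
    have := hblock (σ.symm (i, 0)).1 (σ.symm (i, 0)).2
    simpa using this.symm
  have hA : Function.Injective (LinearMap.pi l) := by
    intro v w hvw
    have : σ (0, v) = σ (0, w) :=
      Prod.ext ((hblock 0 v).trans (hblock 0 w).symm) (by rw [hsnd, hsnd, hvw])
    simpa using σ.injective this
  refine ⟨fun i j => a j ((Equiv.ofBijective _ hπ).symm i),
    LinearEquiv.ofInjectiveEndo _ hA, Equiv.ofBijective _ hπ, ?_⟩
  refine Equiv.ext fun p => Prod.ext (hblock p.1 p.2) ?_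
  rw [hsnd]
  simp only [affinePerm_apply, Equiv.symm_apply_apply, LinearEquiv.coe_ofInjectiveEndo]

theorem range_affinePermHom (d : ℕ) :
    Set.range (affinePermHom d) =
      {σ : Equiv.Perm (Fin 3 × (Fin d → ZMod 2)) | ∀ c ∈ codeD d, c ∘ σ ∈ codeD d} := by
  ext σ
  constructor
  · rintro ⟨g, rfl⟩ c hc
    exact comp_affinePerm_mem_codeD _ _ _ hc
  · intro hσ
    obtain ⟨t, A, π, rfl⟩ := exists_eq_affinePerm hσ
    exact ⟨⟨Multiplicative.ofAdd t, (A, π)⟩, rfl⟩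

theorem card_linearEquiv_zmod_two (d : ℕ) :
    Nat.card ((Fin d → ZMod 2) ≃ₗ[ZMod 2] (Fin d → ZMod 2)) =
      ∏ k ∈ Finset.range d, (2 ^ d - 2 ^ k) := by
  rw [← Nat.card_congr (LinearMap.GeneralLinearGroup.generalLinearEquiv (ZMod 2)
      (Fin d → ZMod 2)).toEquiv,
    ← Nat.card_congr (Matrix.GeneralLinearGroup.toLin (n := Fin d) (R := ZMod 2)).toEquiv,
    Matrix.card_GL_field, ZMod.card, Finset.prod_range]

/-- The automorphism group `F` of the code `D` has order `2^{3d}·6·|GL(d,2)|` and is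
isomorphic to the semidirect product `2^{3d} ⋊ (GL(d,2) × Sym₃)` (translations extended
by the natural action), realized as the range of an injective group homomorphism. -/
theorem stmt_15 (d : ℕ) (hd : 1 ≤ d) :
    (Finset.univ.filter fun σ : Equiv.Perm (Fin 3 × (Fin d → ZMod 2)) =>
        ∀ c ∈ codeD d, c ∘ ⇑σ ∈ codeD d).card =
      2 ^ (3 * d) * 6 * ∏ k ∈ Finset.range d, (2 ^ d - 2 ^ k) ∧
    ∃ φ : SemidirectProduct (Multiplicative (Fin 3 → Fin d → ZMod 2))
        (((Fin d → ZMod 2) ≃ₗ[ZMod 2] (Fin d → ZMod 2)) × Equiv.Perm (Fin 3)) (natAct d) →*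
        Equiv.Perm (Fin 3 × (Fin d → ZMod 2)),
      Function.Injective ⇑φ ∧
        Set.range ⇑φ =
          {σ : Equiv.Perm (Fin 3 × (Fin d → ZMod 2)) | ∀ c ∈ codeD d, c ∘ ⇑σ ∈ codeD d} := by
  refine ⟨?_, affinePermHom d, affinePermHom_injective d, range_affinePermHom d⟩
  have hcard := Nat.card_range_of_injective (affinePermHom_injective d)
  rw [range_affinePermHom, Nat.card_congr SemidirectProduct.equivProd, Nat.card_prod,
    Nat.card_prod, card_linearEquiv_zmod_two] at hcard
  rw [← Fintype.card_subtype, ← Nat.card_eq_fintype_card]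
  refine hcard.trans ?_
  have htrans : Nat.card (Multiplicative (Fin 3 → Fin d → ZMod 2)) = 2 ^ (3 * d) := by
    rw [Nat.card_congr Multiplicative.toAdd]
    simp [← pow_mul, mul_comm]
  have hperm : Nat.card (Equiv.Perm (Fin 3)) = 6 := by
    simp [Nat.card_eq_fintype_card, Fintype.card_perm, Nat.factorial]
  rw [htrans, hperm]
  ring
end
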